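/- Fix a vertex a ≠ 0 and write a_i := p^i(a) for the i-th iterated parent of a (so a_0 = a and a_{d(a)} = 0). For all 0 ≤ j < n ≤ d(a), the mean hitting time of a_j starting from a_n is E[T^{a_n}_{a_j}] = Σ_{k=j}^{n−1} (1 − π(B_{a_k})) / (μ_{a_k}·π(a_k)). -/

import Mathlib

open MeasureTheory ProbabilityTheory Filter Topology ENNReal

noncomputable section

/-- A discrete-time birth-and-death chain on a countable rooted tree `I`.
The tree is encoded by a root, a parent map and a depth function; the chain is
encoded by its transition matrix `P` (nonzero only between tree-neighbours and
on the diagonal) and by the laws `law x` of the trajectories started at `x`,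
characterised by the cylinder formula.  `invm` is the reversible invariant
probability measure of the chain (positive recurrence). -/
structure TreeChain (I : Type*) [MeasurableSpace I] where
  root : I
  par : I → I
  depth : I → ℕ
  par_root : par root = root
  depth_root : depth root = 0
  depth_eq_zero : ∀ x, depth x = 0 → x = root
  depth_par : ∀ x, x ≠ root → depth x = depth (par x) + 1
  P : I → I → ℝ≥0∞
  P_row : ∀ x, ∑' y, P x y = 1
  P_support : ∀ x y, P x y ≠ 0 → y = x ∨ y = par x ∨ x = par y
  lam_pos : ∀ x, x ≠ root → P (par x) x ≠ 0
  mu_pos : ∀ x, x ≠ root → P x (par x) ≠ 0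
  law : I → Measure (ℕ → I)
  law_prob : ∀ x, IsProbabilityMeasure (law x)
  law_start : ∀ x, law x {ω | ω 0 = x} = 1
  law_cyl : ∀ x (n : ℕ) (γ : ℕ → I), γ 0 = x →
    law x {ω | ∀ i ≤ n, ω i = γ i} = ∏ i ∈ Finset.range n, P (γ i) (γ (i + 1))
  invm : I → ℝ≥0∞
  invm_pos : ∀ x, invm x ≠ 0
  invm_sum : ∑' x, invm x = 1
  invm_rev : ∀ x y, invm x * P x y = invm y * P y x

/-- The hitting time of `y`, as an extended nonnegative real (`∞` if `y` is never hit). -/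
def hitTime {I : Type*} (y : I) (ω : ℕ → I) : ℝ≥0∞ :=
  ⨅ (t : ℕ) (_ : ω t = y), (t : ℝ≥0∞)

namespace TreeChain

variable {I : Type*} [MeasurableSpace I] (c : TreeChain I)

/-- The branch `B_x` stemming from `x`: the set of descendants of `x` (including `x`). -/
def branch (x : I) : Set I := {y | ∃ n, c.par^[n] y = x}

/-- The set `ℓ(x)` of vertices on the path from `x` to the root, the root excluded. -/
def pathToRoot (x : I) : Set I := {y | ∃ i < c.depth x, c.par^[i] x = y}

/-- The set `σ(x)` of children of `x`. -/
def children (x : I) : Set I := {y | y ≠ c.root ∧ c.par y = x}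

/-- `μ_x`, the transition probability from `x` to its parent. -/
def mu (x : I) : ℝ≥0∞ := c.P x (c.par x)

/-- `λ_x`, the transition probability from the parent of `x` to `x`. -/
def lamP (x : I) : ℝ≥0∞ := c.P (c.par x) x

/-- `π(A)`, the invariant mass of a set of vertices. -/
def piSet (A : Set I) : ℝ≥0∞ := ∑' y : A, c.invm (y : I)

/-- `E[T^x_y]`, the expected hitting time of `y` for the chain started at `x`. -/
def ET (x y : I) : ℝ≥0∞ := ∫⁻ ω, hitTime y ω ∂(c.law x)

/-- `E[(T^x_y)²]`, the second moment of the hitting time of `y` started at `x`. -/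
def ET2 (x y : I) : ℝ≥0∞ := ∫⁻ ω, (hitTime y ω) ^ 2 ∂(c.law x)

/-- The normalised hitting time `T^x_y / E[T^x_y]` as a real random variable. -/
def ratio (x y : I) (ω : ℕ → I) : ℝ := (hitTime y ω).toReal / (c.ET x y).toReal

/-- `α(a)`: the child of the root lying on the path from `a` to the root. -/
def alphaVert (a : I) : I := c.par^[c.depth a - 1] a

/-- The drift constant `K_a = sup_{b ∈ B_{α(a)}} μ_b · E[T^b_{p(b)}]`. -/
def Kdrift (a : I) : ℝ≥0∞ :=
  ⨆ b ∈ c.branch (c.alphaVert a), c.mu b * c.ET b (c.par b)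

/-- The global constant `K'_a = sup_{b ∈ I} μ_b · E[T^b_{p(b)}]`. -/
def Kdrift' : ℝ≥0∞ := ⨆ b : I, c.mu b * c.ET b (c.par b)

/-- The quantity `Q_x = π(B_x)⁻¹ · Σ_{b ∈ B_x} π(B_b)²/(μ_b π(b))`. -/
def Qx (x : I) : ℝ≥0∞ :=
  (c.piSet (c.branch x))⁻¹ *
    ∑' b : c.branch x, (c.piSet (c.branch (b : I))) ^ 2 / (c.mu (b : I) * c.invm (b : I))

/-- `Q_a = sup_{x ∈ ℓ(a)} Q_x`. -/
def Qsup (a : I) : ℝ≥0∞ := ⨆ x ∈ c.pathToRoot a, c.Qx x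

/-- `R_a = Σ_{b ∈ ℓ(a)} π(B_b)²/(μ_b π(b))`. -/
def Rsum (a : I) : ℝ≥0∞ :=
  ∑' b : c.pathToRoot a, (c.piSet (c.branch (b : I))) ^ 2 / (c.mu (b : I) * c.invm (b : I))

/-- The set `C_{a,k}`: union over the vertices `a_l`, `k < l ≤ d(a)`, of the path from
`a_k` to the root, of the branches stemming from the children of `a_l` other
than `a_{l-1}`. -/
def Cset (a : I) (k : ℕ) : Set I :=
  {y | ∃ l, k + 1 ≤ l ∧ l ≤ c.depth a ∧
    ∃ ch, ch ∈ c.children (c.par^[l] a) ∧ ch ≠ c.par^[l - 1] a ∧ y ∈ c.branch ch}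

end TreeChain

/-- The strong drift condition `0^ℓ-SD` toward the root, for a family of chains
`c n` with distinguished vertices `a n` (the limit `a → ∞` being `n → ∞`). -/
def StrongDrift {I : ℕ → Type*} [∀ n, MeasurableSpace (I n)]
    (c : ∀ n, TreeChain (I n)) (a : ∀ n, I n) : Prop :=
  (∃ Kmu : ℝ≥0∞, 0 < Kmu ∧
      ∀ n, ∀ b ∈ (c n).branch ((c n).alphaVert (a n)), Kmu ≤ (c n).mu b) ∧
  Tendsto (fun n => ((c n).Kdrift (a n)) ^ 2 / (c n).ET (a n) (c n).root) atTop (𝓝 0)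

section HittingTimes

lemma tendsto_tsum_zero_of_le {ι : Type*} {F : ℕ → ι → ℝ≥0∞} {g : ι → ℝ≥0∞}
    (hg : ∑' x, g x ≠ ∞) (hle : ∀ t x, F t x ≤ g x)
    (hF : ∀ x, Tendsto (fun t => F t x) atTop (𝓝 0)) :
    Tendsto (fun t => ∑' x, F t x) atTop (𝓝 0) := by
  let _ : MeasurableSpace ι := ⊤
  have h := tendsto_lintegral_of_dominated_convergence (μ := Measure.count)
    (F := F) (f := fun _ => 0) g (fun _ => measurable_from_top) (fun t => ae_of_all _ (hle t))
    (by rwa [lintegral_count]) (ae_of_all _ hF)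
  simpa [lintegral_count] using h

lemma mem_of_forall_mem_measurableAtom {I : Type*} [MeasurableSpace I] {ω ω' : ℕ → I}
    (h : ∀ i, ω' i ∈ measurableAtom (ω i)) {S : Set (ℕ → I)} (hS : MeasurableSet S)
    (hω : ω ∈ S) : ω' ∈ S := by
  let _ : MeasurableSpace Bool := ⊥
  have hf : Measurable (fun b : Bool => if b then ω else ω') := by
    rw [measurable_pi_iff]
    intro i T hT
    rw [MeasurableSpace.measurableSet_bot_iff]
    by_cases hi : ω i ∈ T
    · have hi' : ω' i ∈ T := mem_of_mem_measurableAtom (h i) hT hi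
      right
      ext b
      cases b <;> simp [hi, hi']
    · have hi' : ω' i ∉ T := fun h' => mem_of_mem_measurableAtom (h i) hT.compl hi h'
      left
      ext b
      cases b <;> simp [hi, hi']
  have := hf hS
  rw [MeasurableSpace.measurableSet_bot_iff] at this
  rcases this with h0 | h1
  · have : true ∈ (fun b : Bool => if b then ω else ω') ⁻¹' S := by simpa using hω
    rw [h0] at this
    exact this.elim
  · have : false ∈ (fun b : Bool => if b then ω else ω') ⁻¹' S := by rw [h1]; trivial
    simpa using this

lemma hitTime_eq_tsum {I : Type*} (y : I) (ω : ℕ → I) :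
    hitTime y ω = ∑' t : ℕ, {ω : ℕ → I | ∀ i ≤ t, ω i ≠ y}.indicator (fun _ => (1 : ℝ≥0∞)) ω := by
  classical
  by_cases h : ∃ t, ω t = y
  · have h1 : hitTime y ω = (Nat.find h : ℝ≥0∞) := by
      apply le_antisymm
      · exact iInf₂_le (f := fun (t : ℕ) (_ : ω t = y) => (t : ℝ≥0∞)) _ (Nat.find_spec h)
      · refine le_iInf₂ fun t ht => ?_
        exact_mod_cast Nat.find_min' h ht
    have h2 : ∀ t : ℕ, {ω : ℕ → I | ∀ i ≤ t, ω i ≠ y}.indicator (fun _ => (1 : ℝ≥0∞)) ω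
        = if t ∈ Finset.range (Nat.find h) then 1 else 0 := by
      intro t
      simp [Set.indicator_apply, Nat.lt_find_iff]
    rw [h1, tsum_congr h2, tsum_eq_sum (s := Finset.range (Nat.find h))
      (fun t ht => if_neg ht), Finset.sum_ite_mem]
    simp
  · push Not at h
    have h1 : hitTime y ω = ⊤ := by simp [hitTime, h]
    simp [h1, h]

namespace TreeChain

variable {I : Type*} [MeasurableSpace I] (c : TreeChain I)

lemma P_ne_top (x y : I) : c.P x y ≠ ∞ :=
  ne_top_of_le_ne_top one_ne_top ((ENNReal.le_tsum y).trans_eq (c.P_row x))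

lemma invm_ne_top (x : I) : c.invm x ≠ ∞ :=
  ne_top_of_le_ne_top one_ne_top ((ENNReal.le_tsum x).trans_eq c.invm_sum)

lemma exists_P_ne_zero {y y' : I} (hne : y ≠ y') : ∃ x, c.P x y ≠ 0 := by
  by_cases hy : y = c.root
  · have key : ∀ n (z : I), c.depth z = n → z ≠ c.root → ∃ w, w ≠ c.root ∧ c.par w = c.root := by
      intro n
      induction n with
      | zero => exact fun z hz hz' => absurd (c.depth_eq_zero z hz) hz'
      | succ n ih =>
        intro z hz hz'
        by_cases hp : c.par z = c.root
        · exact ⟨z, hz', hp⟩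
        · have := c.depth_par z hz'
          exact ih (c.par z) (by omega) hp
    obtain ⟨w, hw, hwr⟩ := key _ y' rfl (hy ▸ hne.symm)
    exact ⟨w, by rw [hy, ← hwr]; exact c.mu_pos w hw⟩
  · exact ⟨_, c.lam_pos y hy⟩

/-- The cylinder formula forces the σ-algebra to separate the vertices. -/
lemma measurableSingletonClass {I : Type*} [MeasurableSpace I] [Countable I] (c : TreeChain I) : MeasurableSingletonClass I := by
  have sep : ∀ y y' : I, y' ∈ measurableAtom y → y = y' := by
    intro y y' hyy
    by_contra hne
    obtain ⟨x, hx⟩ := c.exists_P_ne_zero hne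
    have := c.law_prob x
    let D : I → Set (ℕ → I) := fun z => {ω | ω 0 ∈ measurableAtom x ∧ ω 1 ∈ measurableAtom z}
    have hD : ∀ z, c.law x (D z) ≤ c.P x z := by
      intro z
      have hcyl := c.law_cyl x 1 (fun i => if i = 0 then x else z) (by simp)
      simp only [Finset.range_one, Finset.prod_singleton] at hcyl
      have : c.P x z = c.law x {ω | ∀ i ≤ 1, ω i = if i = 0 then x else z} := by
        rw [hcyl]; simp
      rw [this, ← measure_toMeasurable {ω : ℕ → I | ∀ i ≤ 1, ω i = if i = 0 then x else z}]
      refine measure_mono fun ω hω => ?_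
      have hmem : (fun i => if i = 0 then x else if i = 1 then z else ω i) ∈
          toMeasurable (c.law x) {ω : ℕ → I | ∀ i ≤ 1, ω i = if i = 0 then x else z} := by
        apply subset_toMeasurable
        intro i hi
        have : i = 0 ∨ i = 1 := by omega
        rcases this with rfl | rfl <;> simp
      refine mem_of_forall_mem_measurableAtom (fun i => ?_)
        (measurableSet_toMeasurable _ _) hmem
      by_cases h0 : i = 0
      · subst h0; simpa using hω.1
      by_cases h1 : i = 1
      · subst h1; simpa using hω.2
      · simp [h0, h1, mem_measurableAtom_self]
    have hatom : measurableAtom y = measurableAtom y' :=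
      (measurableAtom_eq_of_mem hyy).symm
    have hPy' : c.P x y' ≠ 0 := by
      have hle : c.P x y ≤ c.law x (D y) := by
        have hcyl := c.law_cyl x 1 (fun i => if i = 0 then x else y) (by simp)
        simp only [Finset.range_one, Finset.prod_singleton] at hcyl
        have : c.P x y = c.law x {ω | ∀ i ≤ 1, ω i = if i = 0 then x else y} := by
          rw [hcyl]; simp
        rw [this]
        refine measure_mono fun ω hω => ?_
        have h0 : ω 0 = x := by simpa using hω 0 (by simp)
        have h1 : ω 1 = y := by simpa using hω 1 le_rfl
        exact ⟨by rw [h0]; exact mem_measurableAtom_self _,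
          by rw [h1]; exact mem_measurableAtom_self _⟩
      have h2 : c.law x (D y) ≤ c.P x y' := by
        have : D y = D y' := by simp only [D, hatom]
        rw [this]; exact hD y'
      exact fun h0 => hx (le_antisymm ((hle.trans h2).trans_eq h0) zero_le)
    have hnull : c.law x {ω | ω 0 ∉ measurableAtom x} = 0 := by
      have hm : MeasurableSet {ω : ℕ → I | ω 0 ∈ measurableAtom x} :=
        measurable_pi_apply 0 (MeasurableSet.measurableAtom_of_countable x)
      have h1 : c.law x {ω : ℕ → I | ω 0 ∈ measurableAtom x} = 1 := by
        refine le_antisymm prob_le_one ((c.law_start x).symm.trans_le (measure_mono ?_))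
        intro ω hω
        have h0 : ω 0 = x := hω
        change ω 0 ∈ measurableAtom x
        rw [h0]; exact mem_measurableAtom_self _
      exact (prob_compl_eq_zero_iff hm).2 h1
    have hcover : (Set.univ : Set (ℕ → I)) ⊆
        {ω | ω 0 ∉ measurableAtom x} ∪ ⋃ z : {z : I // z ≠ y'}, D z := by
      intro ω _
      by_cases h0 : ω 0 ∈ measurableAtom x
      · right
        rw [Set.mem_iUnion]
        by_cases h1 : ω 1 = y'
        · exact ⟨⟨y, hne⟩, h0, by rw [h1]; exact hyy⟩
        · exact ⟨⟨ω 1, h1⟩, h0, mem_measurableAtom_self _⟩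
      · exact Or.inl h0
    have hle : 1 ≤ ∑' z : {z : I // z ≠ y'}, c.P x z := by
      calc (1 : ℝ≥0∞) = c.law x Set.univ := measure_univ.symm
        _ ≤ _ := measure_mono hcover
        _ ≤ _ := measure_union_le _ _
        _ ≤ 0 + ∑' z : {z : I // z ≠ y'}, c.law x (D z) := by
          rw [hnull]; gcongr; exact measure_iUnion_le _
        _ ≤ _ := by rw [zero_add]; exact ENNReal.tsum_le_tsum fun z => hD z
    have hsplit : c.P x y' + ∑' z : {z : I // z ≠ y'}, c.P x z = 1 := by
      have h := Summable.tsum_add_tsum_compl (f := c.P x) (s := {y'})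
        ENNReal.summable ENNReal.summable
      rw [tsum_singleton y' (c.P x), c.P_row] at h
      exact h
    have hfin : c.P x y' + 1 ≤ 0 + 1 := by
      rw [zero_add]
      exact (add_le_add_right hle _).trans_eq hsplit
    exact hPy' (le_antisymm ((ENNReal.add_le_add_iff_right one_ne_top).1 hfin) zero_le)
  refine ⟨fun x => ?_⟩
  have : {x} = measurableAtom x :=
    Set.Subset.antisymm (by simp [mem_measurableAtom_self]) fun z hz => (sep x z hz).symm
  rw [this]
  exact MeasurableSet.measurableAtom_of_countable x

/-- The probability, from `x`, of not visiting `y` up to time `t`. -/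
def survival (y : I) : ℕ → I → ℝ≥0∞
  | 0, x => open Classical in if x = y then 0 else 1
  | t + 1, x => open Classical in if x = y then 0 else ∑' z, c.P x z * survival y t z

lemma survival_self (y : I) (t : ℕ) : c.survival y t y = 0 := by
  cases t <;> simp [survival]

lemma survival_zero_of_ne {x y : I} (h : x ≠ y) : c.survival y 0 x = 1 := by simp [survival, h]

lemma survival_succ_of_ne {x y : I} (h : x ≠ y) (t : ℕ) :
    c.survival y (t + 1) x = ∑' z, c.P x z * c.survival y t z := by simp [survival, h]

lemma survival_le_one (y : I) (t : ℕ) (x : I) : c.survival y t x ≤ 1 := by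
  induction t generalizing x with
  | zero => simp only [survival]; split_ifs <;> simp
  | succ t ih =>
    by_cases h : x = y
    · simp [survival, h]
    · rw [survival_succ_of_ne c h, ← c.P_row x]
      exact ENNReal.tsum_le_tsum fun z => mul_le_of_le_one_right' (ih z)

lemma law_cyl_survival [Countable I] [MeasurableSingletonClass I] (x y : I) (t n : ℕ)
    (γ : ℕ → I) (hγ : γ 0 = x) :
    c.law x {ω | (∀ i ≤ n, ω i = γ i) ∧ ∀ i, n ≤ i → i ≤ n + t → ω i ≠ y}
      = (∏ i ∈ Finset.range n, c.P (γ i) (γ (i + 1))) * c.survival y t (γ n) := by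
  classical
  induction t generalizing n γ with
  | zero =>
    by_cases h : γ n = y
    · rw [h, survival_self, mul_zero]
      convert measure_empty (μ := c.law x)
      ext ω
      simp only [Set.mem_ofPred_eq, Set.mem_empty_iff_false, iff_false, not_and, not_forall]
      intro h1
      exact ⟨n, le_rfl, le_rfl, by simp [h1 n le_rfl, h]⟩
    · rw [survival_zero_of_ne c h, mul_one, ← c.law_cyl x n γ hγ]
      congr 1
      ext ω
      simp only [Set.mem_ofPred_eq, and_iff_left_iff_imp]
      intro h1 i hi hi'
      obtain rfl : i = n := by omega
      rwa [h1 i le_rfl]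
  | succ t ih =>
    by_cases h : γ n = y
    · rw [h, survival_self, mul_zero]
      convert measure_empty (μ := c.law x)
      ext ω
      simp only [Set.mem_ofPred_eq, Set.mem_empty_iff_false, iff_false, not_and, not_forall]
      intro h1
      exact ⟨n, le_rfl, by omega, by simp [h1 n le_rfl, h]⟩
    · have hunion : {ω : ℕ → I | (∀ i ≤ n, ω i = γ i) ∧ ∀ i, n ≤ i → i ≤ n + (t + 1) → ω i ≠ y}
          = ⋃ z : I, {ω | (∀ i ≤ n + 1, ω i = Function.update γ (n + 1) z i) ∧
              ∀ i, n + 1 ≤ i → i ≤ n + 1 + t → ω i ≠ y} := by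
        ext ω
        simp only [Set.mem_ofPred_eq, Set.mem_iUnion]
        constructor
        · rintro ⟨h1, h2⟩
          refine ⟨ω (n + 1), fun i hi => ?_, fun i hi hi' => h2 i (by omega) (by omega)⟩
          by_cases hin : i = n + 1
          · subst hin; simp
          · rw [Function.update_of_ne hin]; exact h1 i (by omega)
        · rintro ⟨z, h1, h2⟩
          have h3 : ∀ i ≤ n, ω i = γ i := fun i hi => by
            rw [h1 i (by omega), Function.update_of_ne (by omega)]
          refine ⟨h3, fun i hi hi' => ?_⟩
          by_cases hin : i = n
          · subst hin; rwa [h3 i le_rfl]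
          · exact h2 i (by omega) (by omega)
      rw [hunion, measure_iUnion, survival_succ_of_ne c h, ← ENNReal.tsum_mul_left]
      · refine tsum_congr fun z => ?_
        rw [ih (n + 1) _ (by rw [Function.update_of_ne (by omega), hγ]), Finset.prod_range_succ]
        have : ∏ i ∈ Finset.range n, c.P (Function.update γ (n + 1) z i)
            (Function.update γ (n + 1) z (i + 1)) = ∏ i ∈ Finset.range n, c.P (γ i) (γ (i + 1)) := by
          refine Finset.prod_congr rfl fun i hi => ?_
          have := Finset.mem_range.1 hi
          rw [Function.update_of_ne (by omega), Function.update_of_ne (by omega)]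
        rw [this, Function.update_self, Function.update_of_ne (by omega), mul_assoc]
      · intro z z' hzz
        refine Set.disjoint_left.2 fun ω hω hω' => hzz ?_
        have h1 := hω.1 (n + 1) le_rfl
        have h2 := hω'.1 (n + 1) le_rfl
        rw [Function.update_self] at h1 h2
        exact h1.symm.trans h2
      · intro z
        measurability

lemma law_forall_ne [Countable I] [MeasurableSingletonClass I] (x y : I) (t : ℕ) :
    c.law x {ω | ∀ i ≤ t, ω i ≠ y} = c.survival y t x := by
  have := c.law_prob x
  have h := c.law_cyl_survival x y t 0 (fun _ => x) rfl
  rw [Finset.range_zero, Finset.prod_empty, one_mul] at h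
  rw [← h]
  have hm : MeasurableSet {ω : ℕ → I | ω 0 = x} :=
    measurable_pi_apply (X := fun _ : ℕ => I) 0 (measurableSet_singleton x)
  have hae : ∀ᵐ ω ∂c.law x, ω 0 = x := (prob_compl_eq_zero_iff hm).2 (c.law_start x)
  refine measure_congr ?_
  filter_upwards [hae] with ω hω
  refine propext ?_
  change (∀ i ≤ t, ω i ≠ y) ↔ (∀ i ≤ 0, ω i = x) ∧ ∀ i, 0 ≤ i → i ≤ 0 + t → ω i ≠ y
  simp [hω]

lemma ET_eq_tsum_survival [Countable I] (x y : I) : c.ET x y = ∑' t, c.survival y t x := by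
  have := c.measurableSingletonClass
  have hm : ∀ t : ℕ, MeasurableSet {ω : ℕ → I | ∀ i ≤ t, ω i ≠ y} := fun t => by measurability
  simp only [ET, hitTime_eq_tsum]
  rw [lintegral_tsum fun t => (measurable_const.indicator (hm t)).aemeasurable]
  refine tsum_congr fun t => ?_
  rw [lintegral_indicator (hm t), setLIntegral_one, law_forall_ne]

lemma tsum_invm_mul_P (f : I → ℝ≥0∞) :
    ∑' x, c.invm x * ∑' z, c.P x z * f z = ∑' x, c.invm x * f x := by
  simp only [← ENNReal.tsum_mul_left, ← mul_assoc]
  rw [ENNReal.tsum_comm]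
  refine tsum_congr fun z => ?_
  simp only [fun x => c.invm_rev x z]
  rw [ENNReal.tsum_mul_right, ENNReal.tsum_mul_left, c.P_row, mul_one]

/-- The chain is irreducible. -/
lemma mem_of_forall_adj (Z : Set I) {y : I} (hy : y ∈ Z)
    (hZ : ∀ x z, x ∈ Z → c.P x z ≠ 0 → z ∈ Z) (x : I) : x ∈ Z := by
  have up : ∀ n (z : I), c.depth z = n → z ∈ Z → c.root ∈ Z := by
    intro n
    induction n with
    | zero => exact fun z hz hz' => c.depth_eq_zero z hz ▸ hz'
    | succ n ih =>
      intro z hz hz'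
      have hr : z ≠ c.root := by rintro rfl; rw [c.depth_root] at hz; omega
      have := c.depth_par z hr
      exact ih (c.par z) (by omega) (hZ z _ hz' (c.mu_pos z hr))
  have down : ∀ n (z : I), c.depth z = n → z ∈ Z := by
    intro n
    induction n with
    | zero => exact fun z hz => c.depth_eq_zero z hz ▸ up _ y rfl hy
    | succ n ih =>
      intro z hz
      have hr : z ≠ c.root := by rintro rfl; rw [c.depth_root] at hz; omega
      have := c.depth_par z hr
      exact hZ (c.par z) z (ih _ (by omega)) (c.lam_pos z hr)
  exact down _ x rfl

lemma tendsto_survival (x y : I) : Tendsto (fun t => c.survival y t x) atTop (𝓝 0) := by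
  classical
  have of_P : ∀ x z, c.P x z ≠ 0 →
      Tendsto (fun t => ∑' z, c.P x z * c.survival y t z) atTop (𝓝 0) →
      Tendsto (fun t => c.survival y t z) atTop (𝓝 0) := by
    intro x z hP h
    have h1 : Tendsto (fun t => c.P x z * c.survival y t z) atTop (𝓝 0) :=
      tendsto_of_tendsto_of_tendsto_of_le_of_le tendsto_const_nhds h (fun _ => zero_le)
        fun t => ENNReal.le_tsum z
    have h2 := ENNReal.Tendsto.const_mul (a := (c.P x z)⁻¹) h1 (Or.inr (ENNReal.inv_ne_top.2 hP))
    simpa only [← mul_assoc, ENNReal.inv_mul_cancel hP (c.P_ne_top x z), one_mul, mul_zero] using h2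
  have hstep : ∀ t, (∑' x, c.invm x * c.survival y (t + 1) x) +
      c.invm y * ∑' z, c.P y z * c.survival y t z = ∑' x, c.invm x * c.survival y t x := by
    intro t
    rw [← c.tsum_invm_mul_P (c.survival y t)]
    rw [← tsum_ite_eq y (fun x => c.invm x * ∑' z, c.P x z * c.survival y t z), ← ENNReal.tsum_add]
    refine tsum_congr fun x => ?_
    by_cases h : x = y
    · simp [h, survival_self]
    · simp [h, survival_succ_of_ne]
  have htel : ∀ N, (∑' x, c.invm x * c.survival y N x) +
      ∑ t ∈ Finset.range N, c.invm y * ∑' z, c.P y z * c.survival y t z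
        = ∑' x, c.invm x * c.survival y 0 x := by
    intro N
    induction N with
    | zero => simp
    | succ N ih => rw [Finset.sum_range_succ, ← ih, ← hstep N]; ring
  have hbound : ∑' x, c.invm x * c.survival y 0 x ≤ 1 := by
    rw [← c.invm_sum]
    exact ENNReal.tsum_le_tsum fun x => mul_le_of_le_one_right' (c.survival_le_one y 0 x)
  have hsum : ∑' t, c.invm y * ∑' z, c.P y z * c.survival y t z ≤ 1 := by
    rw [ENNReal.tsum_eq_iSup_nat]
    exact iSup_le fun N => (le_add_self.trans_eq (htel N)).trans hbound
  have hy : Tendsto (fun t => ∑' z, c.P y z * c.survival y t z) atTop (𝓝 0) := by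
    rw [ENNReal.tsum_mul_left] at hsum
    refine ENNReal.tendsto_atTop_zero_of_tsum_ne_top fun htop => ?_
    rw [htop, ENNReal.mul_top (c.invm_pos y)] at hsum
    exact absurd hsum (by simp)
  refine c.mem_of_forall_adj {x | Tendsto (fun t => c.survival y t x) atTop (𝓝 0)} (y := y)
    (by simp [survival_self]) (fun x z hx hP => of_P x z hP ?_) x
  by_cases h : x = y
  · exact h ▸ hy
  · have := (tendsto_add_atTop_iff_nat 1).2 hx
    simpa only [survival_succ_of_ne c h] using this

lemma tendsto_tsum_invm_survival (y : I) :
    Tendsto (fun t => ∑' x, c.invm x * c.survival y t x) atTop (𝓝 0) := by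
  refine tendsto_tsum_zero_of_le (g := c.invm) (by rw [c.invm_sum]; exact one_ne_top)
    (fun t x => mul_le_of_le_one_right' (c.survival_le_one y t x)) fun x => ?_
  simpa using ENNReal.Tendsto.const_mul (c.tendsto_survival x y) (Or.inr (c.invm_ne_top x))

lemma mem_branch_of_par_mem {b x : I} (h : c.par x ∈ c.branch b) : x ∈ c.branch b := by
  obtain ⟨n, hn⟩ := h
  exact ⟨n + 1, hn⟩

lemma depth_iterate_par (x : I) {k : ℕ} (hk : k ≤ c.depth x) :
    c.depth (c.par^[k] x) = c.depth x - k := by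
  induction k with
  | zero => rfl
  | succ k ih =>
    have h := ih (by omega)
    rw [Function.iterate_succ_apply']
    have hr : c.par^[k] x ≠ c.root := by
      intro h'
      rw [h', c.depth_root] at h
      omega
    have := c.depth_par _ hr
    omega

lemma par_notMem_branch {b : I} (hb : b ≠ c.root) : c.par b ∉ c.branch b := by
  have anti : ∀ n x, c.depth (c.par^[n] x) ≤ c.depth x := by
    intro n
    induction n with
    | zero => exact fun x => le_rfl
    | succ n ih =>
      intro x
      refine (ih (c.par x)).trans ?_
      by_cases h : x = c.root
      · rw [h, c.par_root]
      · rw [c.depth_par x h]; omega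
  rintro ⟨n, hn⟩
  have := anti n (c.par b)
  rw [hn, c.depth_par b hb] at this
  omega

lemma eq_of_P_ne_zero_of_notMem_branch {b x z : I} (hx : x ∉ c.branch b) (hz : z ∈ c.branch b)
    (hP : c.P x z ≠ 0) : z = b ∧ x = c.par b := by
  rcases c.P_support x z hP with h | h | h
  · exact absurd (h ▸ hz) hx
  · exact absurd (c.mem_branch_of_par_mem (h ▸ hz)) hx
  · obtain ⟨n, hn⟩ := hz
    cases n with
    | zero =>
      obtain rfl : z = b := hn
      exact ⟨rfl, h⟩
    | succ n => exact absurd ⟨n, by rw [h]; exact hn⟩ hx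

/-- Balance of the flow through the edge between `b` and its parent. -/
lemma tsum_compl_branch_balance {b : I} (hb : b ≠ c.root) (f : I → ℝ≥0∞) :
    (∑' x, (c.branch b)ᶜ.indicator (fun x => c.invm x * ∑' z, c.P x z * f z) x) +
        c.mu b * c.invm b * f (c.par b)
      = (∑' x, (c.branch b)ᶜ.indicator (fun x => c.invm x * f x) x) +
        c.mu b * c.invm b * f b := by
  classical
  have hpb := c.par_notMem_branch hb
  have hbb : b ∈ c.branch b := ⟨0, rfl⟩
  have hrev : c.invm (c.par b) * c.P (c.par b) b = c.mu b * c.invm b := by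
    rw [c.invm_rev, mul_comm, mu]
  have hswap : ∑' x, (c.branch b)ᶜ.indicator (fun x => c.invm x * ∑' z, c.P x z * f z) x
      = ∑' z, (∑' x, (c.branch b)ᶜ.indicator (fun x => c.invm z * c.P z x) x) * f z := by
    simp only [← ENNReal.tsum_mul_right]
    rw [ENNReal.tsum_comm]
    refine tsum_congr fun x => ?_
    by_cases hx : x ∈ c.branch b
    · simp [hx]
    · simp only [Set.indicator_of_mem (show x ∈ (c.branch b)ᶜ from hx), ← ENNReal.tsum_mul_left,
        ← mul_assoc, c.invm_rev x]
  rw [hswap, ← tsum_ite_eq (c.par b) (fun x => c.mu b * c.invm b * f x),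
    ← tsum_ite_eq b (fun x => c.mu b * c.invm b * f x), ← ENNReal.tsum_add, ← ENNReal.tsum_add]
  refine tsum_congr fun z => ?_
  by_cases hz : z ∈ c.branch b
  · have hzp : z ≠ c.par b := fun h => hpb (h ▸ hz)
    have hzc : z ∉ (c.branch b)ᶜ := fun h => h hz
    rw [if_neg hzp, add_zero, Set.indicator_of_notMem hzc, zero_add]
    have key : ∀ x, (c.branch b)ᶜ.indicator (fun x => c.invm z * c.P z x) x
        = if x = c.par b then (if z = b then c.mu b * c.invm b else 0) else 0 := by
      intro x
      by_cases hx : x ∈ c.branch b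
      · have : x ≠ c.par b := fun h => hpb (h ▸ hx)
        simp [hx, this]
      · rw [Set.indicator_of_mem (show x ∈ (c.branch b)ᶜ from hx), ← c.invm_rev]
        by_cases hP : c.P x z = 0
        · rw [hP, mul_zero]
          split_ifs with h1 h2
          · rw [h1, h2] at hP
            exact absurd hP (c.lam_pos b hb)
          · rfl
          · rfl
        · obtain ⟨rfl, rfl⟩ := c.eq_of_P_ne_zero_of_notMem_branch hx hz hP
          simp [hrev]
    rw [tsum_congr key, tsum_ite_eq]
    split_ifs <;> simp
  · have hzb : z ≠ b := fun h => hz (h ▸ hbb)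
    rw [if_neg hzb, add_zero, Set.indicator_of_mem (show z ∈ (c.branch b)ᶜ from hz)]
    have key : ∀ x, (c.branch b)ᶜ.indicator (fun x => c.invm z * c.P z x) x +
        (if x = b then (if z = c.par b then c.mu b * c.invm b else 0) else 0)
          = c.invm z * c.P z x := by
      intro x
      by_cases hx : x ∈ c.branch b
      · rw [Set.indicator_of_notMem (show x ∉ (c.branch b)ᶜ from fun h => h hx), zero_add]
        by_cases hP : c.P z x = 0
        · rw [hP, mul_zero]
          split_ifs with h1 h2
          · rw [h1, h2] at hP
            exact absurd hP (c.lam_pos b hb)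
          · rfl
          · rfl
        · obtain ⟨rfl, rfl⟩ := c.eq_of_P_ne_zero_of_notMem_branch hz hx hP
          simp [hrev]
      · have : x ≠ b := fun h => hx (h ▸ hbb)
        simp [hx, this]
    have hsum := tsum_congr (L := SummationFilter.unconditional I) key
    rw [ENNReal.tsum_add, tsum_ite_eq, ENNReal.tsum_mul_left, c.P_row, mul_one] at hsum
    have hmul := congrArg (· * f z) hsum
    simp only [add_mul, ite_mul, zero_mul] at hmul
    exact hmul

lemma ET_par [Countable I] {b y : I} (hb : b ≠ c.root) (hy : y ∈ c.branch b) :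
    c.ET (c.par b) y = c.ET b y + (1 - c.piSet (c.branch b)) / (c.mu b * c.invm b) := by
  classical
  set w := c.mu b * c.invm b
  have hw0 : w ≠ 0 := mul_ne_zero (c.mu_pos b hb) (c.invm_pos b)
  have hwt : w ≠ ∞ := ENNReal.mul_ne_top (c.P_ne_top _ _) (c.invm_ne_top b)
  let m : ℕ → ℝ≥0∞ := fun t =>
    ∑' x, (c.branch b)ᶜ.indicator (fun x => c.invm x * c.survival y t x) x
  have hne : ∀ x ∈ (c.branch b)ᶜ, x ≠ y := fun x hx h => hx (h ▸ hy)
  have hstep : ∀ t, m (t + 1) + w * c.survival y t (c.par b) = m t + w * c.survival y t b := by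
    intro t
    rw [← c.tsum_compl_branch_balance hb]
    congr 1
    refine tsum_congr fun x => congrFun (Set.indicator_congr fun x hx => ?_) x
    rw [survival_succ_of_ne c (hne x hx)]
  have htel : ∀ N, m N + w * ∑ t ∈ Finset.range N, c.survival y t (c.par b)
      = m 0 + w * ∑ t ∈ Finset.range N, c.survival y t b := by
    intro N
    induction N with
    | zero => simp
    | succ N ih =>
      rw [Finset.sum_range_succ, Finset.sum_range_succ, mul_add, mul_add, ← add_assoc (m 0), ← ih,
        add_right_comm (m N), ← hstep N]
      ring
  have hm : Tendsto m atTop (𝓝 0) :=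
    tendsto_of_tendsto_of_tendsto_of_le_of_le tendsto_const_nhds (c.tendsto_tsum_invm_survival y)
      (fun _ => zero_le) fun t => ENNReal.tsum_le_tsum fun x => Set.indicator_le_self _ _ x
  have hlim : w * c.ET (c.par b) y = m 0 + w * c.ET b y := by
    rw [ET_eq_tsum_survival, ET_eq_tsum_survival]
    have hL := hm.add (ENNReal.Tendsto.const_mul (a := w)
      (ENNReal.tendsto_nat_tsum fun t => c.survival y t (c.par b)) (Or.inr hwt))
    have hR := (tendsto_const_nhds (x := m 0)).add (ENNReal.Tendsto.const_mul (a := w)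
      (ENNReal.tendsto_nat_tsum fun t => c.survival y t b) (Or.inr hwt))
    rw [zero_add] at hL
    exact tendsto_nhds_unique hL (hR.congr fun N => (htel N).symm)
  have hm0 : m 0 = 1 - c.piSet (c.branch b) := by
    have h1 : m 0 = ∑' x : ↥(c.branch b)ᶜ, c.invm x := by
      rw [tsum_subtype]
      refine tsum_congr fun x => congrFun (Set.indicator_congr fun x hx => ?_) x
      rw [survival_zero_of_ne c (hne x hx), mul_one]
    have h2 : c.piSet (c.branch b) + m 0 = 1 := by
      rw [h1, ← c.invm_sum]
      exact Summable.tsum_add_tsum_compl ENNReal.summable ENNReal.summable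
    refine ENNReal.eq_sub_of_add_eq' one_ne_top ?_
    rw [add_comm, h2]
  rw [← hm0]
  refine (ENNReal.mul_right_inj hw0 hwt).1 ?_
  rw [hlim, mul_add, ENNReal.mul_div_cancel hw0 hwt, add_comm]

end TreeChain

end HittingTimes

/-- **Proposition (mean hitting times), ancestor → descendant**: for `0 ≤ j < n ≤ d(a)`,
`E[T^{a_n}_{a_j}] = Σ_{k=j}^{n−1} (1 − π(B_{a_k}))/(μ_{a_k} π(a_k))`, where `a_i = p^i(a)`. -/
theorem ET_iterate_down {I : Type*} [MeasurableSpace I] [Countable I]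
    (c : TreeChain I) (a : I) (ha : a ≠ c.root)
    (j n : ℕ) (hjn : j < n) (hn : n ≤ c.depth a) :
    c.ET (c.par^[n] a) (c.par^[j] a)
      = ∑ k ∈ Finset.Ico j n,
          (1 - c.piSet (c.branch (c.par^[k] a))) /
            (c.mu (c.par^[k] a) * c.invm (c.par^[k] a)) := by
  have key : ∀ m, j ≤ m → m ≤ c.depth a → c.ET (c.par^[m] a) (c.par^[j] a)
      = ∑ k ∈ Finset.Ico j m,
          (1 - c.piSet (c.branch (c.par^[k] a))) /
            (c.mu (c.par^[k] a) * c.invm (c.par^[k] a)) := by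
    intro m hm
    induction m, hm using Nat.le_induction with
    | base => simp [TreeChain.ET_eq_tsum_survival, TreeChain.survival_self]
    | succ m hm ih =>
      intro hmd
      have hr : c.par^[m] a ≠ c.root := by
        intro h
        have := c.depth_iterate_par a (k := m) (by omega)
        rw [h, c.depth_root] at this
        omega
      have hmem : c.par^[j] a ∈ c.branch (c.par^[m] a) :=
        ⟨m - j, by rw [← Function.iterate_add_apply, Nat.sub_add_cancel hm]⟩
      rw [Finset.sum_Ico_succ_top hm, ← ih (by omega), Function.iterate_succ_apply',
        c.ET_par hr hmem]
  exact key n hjn.le hn
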